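/- arXiv:0706.2372 — 7 statements merged into one kernel-verified Lean document; each statement's English description precedes it below -/
import Mathlib

section
/- Let g0, n be natural numbers with n ≥ 1, set g1 = g0 + n − 1 and g = g1 + g0 = 2g0 + n − 1. Let A, D be complex (g1 × g0)-matrices, B, E complex (g1 × (n−1))-matrices, and G, J complex (g0 × g0)-matrices. Let Ω be the g × 2g block matrix with block rows [A B −A D E −D] and [G 0 G J 0 J], let L_Ω ⊆ ℂ^g be the ℤ-span of the columns of Ω, and let L_Γ ⊆ ℂ^{g1} be the ℤ-span of the columns of Γ = [2A B 2D E]. Assume the 2g0 columns of the block matrix (G J) are linearly independent over ℤ. Then for every t ∈ ℂ^{g1}, the vector (t, 0) ∈ ℂ^{g1} × ℂ^{g0} = ℂ^g lies in L_Ω if and only if t lies in L_Γ; consequently the additive group homomorphism ℂ^{g1}/L_Γ → ℂ^g/L_Ω induced by t ↦ (t, 0) is injective. -/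
open Matrix

/-- Multiplying by an integral unit vector picks out a column. -/
lemma mulVec_intCast_single {p q : ℕ} (M : Matrix (Fin p) (Fin q) ℂ) (j : Fin q) :
    M.mulVec (fun k => (((Pi.single j 1 : Fin q → ℤ) k : ℤ) : ℂ)) = fun i => M i j := by
  have h : (fun k => (((Pi.single j 1 : Fin q → ℤ) k : ℤ) : ℂ)) = Pi.single j 1 := by
    funext k
    by_cases hk : k = j
    · subst hk; simp
    · simp [hk]
  rw [h, Matrix.mulVec_single_one]
  rfl

lemma mulVec_intCast_zero {p q : ℕ} (M : Matrix (Fin p) (Fin q) ℂ) :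
    M.mulVec (fun k => (((0 : Fin q → ℤ) k : ℤ) : ℂ)) = 0 := by
  funext i; simp [Matrix.mulVec, dotProduct]

lemma mulVec_intCast_add {p q : ℕ} (M : Matrix (Fin p) (Fin q) ℂ) (a b : Fin q → ℤ) :
    M.mulVec (fun k => (((a + b) k : ℤ) : ℂ)) =
      M.mulVec (fun k => (a k : ℂ)) + M.mulVec (fun k => (b k : ℂ)) := by
  rw [← Matrix.mulVec_add]; congr 1; funext k; simp

lemma mulVec_intCast_neg {p q : ℕ} (M : Matrix (Fin p) (Fin q) ℂ) (a : Fin q → ℤ) :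
    M.mulVec (fun k => (((-a) k : ℤ) : ℂ)) = - M.mulVec (fun k => (a k : ℂ)) := by
  rw [← Matrix.mulVec_neg]; congr 1; funext k; simp

/-- Ω is the period matrix of the Jacobian of a double cover, written in
blocks `[A B −A D E −D ; G 0 G J 0 J]`, `L_Ω ⊆ ℂ^g` is the ℤ-span of its columns, and
`Γ = (2A B 2D E)` is the period matrix of the Prym variety with period lattice `L_Γ ⊆ ℂ^{g1}`.
If the `2 g0` columns of `(G J)` are ℤ-linearly independent, then for every `t ∈ ℂ^{g1}` the
vector `(t, 0) ∈ ℂ^{g1} × ℂ^{g0}` lies in `L_Ω` iff `t ∈ L_Γ`; consequently the induced group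
homomorphism `ℂ^{g1}/L_Γ → ℂ^g/L_Ω` is injective. -/
theorem prym_torus_embeds_in_jacobian
    (g0 n : ℕ) (hn : 1 ≤ n)
    (A D : Matrix (Fin (g0 + (n - 1))) (Fin g0) ℂ)
    (B E : Matrix (Fin (g0 + (n - 1))) (Fin (n - 1)) ℂ)
    (G J : Matrix (Fin g0) (Fin g0) ℂ)
    (LΩ : AddSubgroup ((Fin (g0 + (n - 1)) → ℂ) × (Fin g0 → ℂ)))
    (hLΩ : LΩ = AddSubgroup.closure
      (Set.range (fun j : Fin g0 =>
          ((fun i => A i j, fun i => G i j) : (Fin (g0 + (n - 1)) → ℂ) × (Fin g0 → ℂ))) ∪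
       Set.range (fun j : Fin (n - 1) =>
          ((fun i => B i j, 0) : (Fin (g0 + (n - 1)) → ℂ) × (Fin g0 → ℂ))) ∪
       Set.range (fun j : Fin g0 =>
          ((fun i => -A i j, fun i => G i j) : (Fin (g0 + (n - 1)) → ℂ) × (Fin g0 → ℂ))) ∪
       Set.range (fun j : Fin g0 =>
          ((fun i => D i j, fun i => J i j) : (Fin (g0 + (n - 1)) → ℂ) × (Fin g0 → ℂ))) ∪
       Set.range (fun j : Fin (n - 1) =>
          ((fun i => E i j, 0) : (Fin (g0 + (n - 1)) → ℂ) × (Fin g0 → ℂ))) ∪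
       Set.range (fun j : Fin g0 =>
          ((fun i => -D i j, fun i => J i j) : (Fin (g0 + (n - 1)) → ℂ) × (Fin g0 → ℂ)))))
    (LΓ : AddSubgroup (Fin (g0 + (n - 1)) → ℂ))
    (hLΓ : LΓ = AddSubgroup.closure
      (Set.range (fun j : Fin g0 => (fun i => 2 * A i j : Fin (g0 + (n - 1)) → ℂ)) ∪
       Set.range (fun j : Fin (n - 1) => (fun i => B i j : Fin (g0 + (n - 1)) → ℂ)) ∪
       Set.range (fun j : Fin g0 => (fun i => 2 * D i j : Fin (g0 + (n - 1)) → ℂ)) ∪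
       Set.range (fun j : Fin (n - 1) => (fun i => E i j : Fin (g0 + (n - 1)) → ℂ))))
    (hindep : ∀ m m' : Fin g0 → ℤ,
      G.mulVec (fun j => (m j : ℂ)) + J.mulVec (fun j => (m' j : ℂ)) = 0 →
      m = 0 ∧ m' = 0) :
    (∀ t : Fin (g0 + (n - 1)) → ℂ,
        ((t, (0 : Fin g0 → ℂ)) ∈ LΩ ↔ t ∈ LΓ)) ∧
    (∀ h : LΓ ≤ LΩ.comap (AddMonoidHom.inl (Fin (g0 + (n - 1)) → ℂ) (Fin g0 → ℂ)),
      Function.Injective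
        (QuotientAddGroup.map LΓ LΩ
          (AddMonoidHom.inl (Fin (g0 + (n - 1)) → ℂ) (Fin g0 → ℂ)) h)) := by
  have hA : ∀ j, (fun i => 2 * A i j) ∈ LΓ := fun j => by
    rw [hLΓ]; exact AddSubgroup.subset_closure (Or.inl (Or.inl (Or.inl ⟨j, rfl⟩)))
  have hB : ∀ j, (fun i => B i j) ∈ LΓ := fun j => by
    rw [hLΓ]; exact AddSubgroup.subset_closure (Or.inl (Or.inl (Or.inr ⟨j, rfl⟩)))
  have hD : ∀ j, (fun i => 2 * D i j) ∈ LΓ := fun j => by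
    rw [hLΓ]; exact AddSubgroup.subset_closure (Or.inl (Or.inr ⟨j, rfl⟩))
  have hE : ∀ j, (fun i => E i j) ∈ LΓ := fun j => by
    rw [hLΓ]; exact AddSubgroup.subset_closure (Or.inr ⟨j, rfl⟩)
  have key : ∀ x ∈ LΩ, ∃ m m' : Fin g0 → ℤ,
      x.2 = G.mulVec (fun j => (m j : ℂ)) + J.mulVec (fun j => (m' j : ℂ)) ∧
      x.1 - (A.mulVec (fun j => (m j : ℂ)) + D.mulVec (fun j => (m' j : ℂ))) ∈ LΓ := by
    intro x hx
    rw [hLΩ] at hx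
    induction hx using AddSubgroup.closure_induction with
    | mem x hx =>
      rcases hx with ((((⟨j, rfl⟩ | ⟨j, rfl⟩) | ⟨j, rfl⟩) | ⟨j, rfl⟩) | ⟨j, rfl⟩) | ⟨j, rfl⟩
      · refine ⟨Pi.single j 1, 0, ?_, ?_⟩ <;>
          simp only [mulVec_intCast_single, mulVec_intCast_zero, add_zero, sub_self]
        exact LΓ.zero_mem
      · refine ⟨0, 0, ?_, ?_⟩ <;>
          simp only [mulVec_intCast_zero, add_zero, sub_zero]
        exact hB j
      · refine ⟨Pi.single j 1, 0, ?_, ?_⟩ <;>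
          simp only [mulVec_intCast_single, mulVec_intCast_zero, add_zero]
        convert LΓ.neg_mem (hA j) using 1
        funext i; simp only [Pi.sub_apply, Pi.neg_apply]; ring
      · refine ⟨0, Pi.single j 1, ?_, ?_⟩ <;>
          simp only [mulVec_intCast_single, mulVec_intCast_zero, zero_add, sub_self]
        exact LΓ.zero_mem
      · refine ⟨0, 0, ?_, ?_⟩ <;>
          simp only [mulVec_intCast_zero, add_zero, sub_zero]
        exact hE j
      · refine ⟨0, Pi.single j 1, ?_, ?_⟩ <;>
          simp only [mulVec_intCast_single, mulVec_intCast_zero, zero_add]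
        convert LΓ.neg_mem (hD j) using 1
        funext i; simp only [Pi.sub_apply, Pi.neg_apply]; ring
    | zero =>
      refine ⟨0, 0, ?_, ?_⟩ <;>
        simp only [mulVec_intCast_zero, add_zero, sub_zero, Prod.snd_zero, Prod.fst_zero]
      exact LΓ.zero_mem
    | add x y _ _ ihx ihy =>
      obtain ⟨a, a', h1, h2⟩ := ihx
      obtain ⟨b, b', h3, h4⟩ := ihy
      refine ⟨a + b, a' + b', ?_, ?_⟩
      · simp only [mulVec_intCast_add, Prod.snd_add, h1, h3]; abel
      · convert LΓ.add_mem h2 h4 using 1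
        simp only [mulVec_intCast_add, Prod.fst_add]; abel
    | neg x _ ih =>
      obtain ⟨a, a', h1, h2⟩ := ih
      refine ⟨-a, -a', ?_, ?_⟩
      · simp only [mulVec_intCast_neg, Prod.snd_neg, h1]; abel
      · convert LΓ.neg_mem h2 using 1
        simp only [mulVec_intCast_neg, Prod.fst_neg]; abel
  have fwd : ∀ t : Fin (g0 + (n - 1)) → ℂ, (t, (0 : Fin g0 → ℂ)) ∈ LΩ → t ∈ LΓ := by
    intro t ht
    obtain ⟨m, m', h1, h2⟩ := key _ ht
    obtain ⟨rfl, rfl⟩ := hindep m m' h1.symm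
    simpa only [mulVec_intCast_zero, add_zero, sub_zero] using h2
  have bwd : LΓ ≤ LΩ.comap (AddMonoidHom.inl (Fin (g0 + (n - 1)) → ℂ) (Fin g0 → ℂ)) := by
    rw [hLΓ, AddSubgroup.closure_le]
    rintro _ (((⟨j, rfl⟩ | ⟨j, rfl⟩) | ⟨j, rfl⟩) | ⟨j, rfl⟩)
    · have h1 : ((fun i => A i j, fun i => G i j) :
          (Fin (g0 + (n - 1)) → ℂ) × (Fin g0 → ℂ)) ∈ LΩ := by
        rw [hLΩ]; exact AddSubgroup.subset_closure
          (Or.inl (Or.inl (Or.inl (Or.inl (Or.inl ⟨j, rfl⟩)))))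
      have h2 : ((fun i => -A i j, fun i => G i j) :
          (Fin (g0 + (n - 1)) → ℂ) × (Fin g0 → ℂ)) ∈ LΩ := by
        rw [hLΩ]; exact AddSubgroup.subset_closure
          (Or.inl (Or.inl (Or.inl (Or.inr ⟨j, rfl⟩))))
      show ((fun i => 2 * A i j, 0) : (Fin (g0 + (n - 1)) → ℂ) × (Fin g0 → ℂ)) ∈ LΩ
      convert LΩ.sub_mem h1 h2 using 1
      ext i
      · simp only [Prod.fst_sub, Pi.sub_apply]; ring
      · simp
    · show ((fun i => B i j, 0) : (Fin (g0 + (n - 1)) → ℂ) × (Fin g0 → ℂ)) ∈ LΩ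
      rw [hLΩ]; exact AddSubgroup.subset_closure
        (Or.inl (Or.inl (Or.inl (Or.inl (Or.inr ⟨j, rfl⟩)))))
    · have h1 : ((fun i => D i j, fun i => J i j) :
          (Fin (g0 + (n - 1)) → ℂ) × (Fin g0 → ℂ)) ∈ LΩ := by
        rw [hLΩ]; exact AddSubgroup.subset_closure
          (Or.inl (Or.inl (Or.inr ⟨j, rfl⟩)))
      have h2 : ((fun i => -D i j, fun i => J i j) :
          (Fin (g0 + (n - 1)) → ℂ) × (Fin g0 → ℂ)) ∈ LΩ := by
        rw [hLΩ]; exact AddSubgroup.subset_closure (Or.inr ⟨j, rfl⟩)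
      show ((fun i => 2 * D i j, 0) : (Fin (g0 + (n - 1)) → ℂ) × (Fin g0 → ℂ)) ∈ LΩ
      convert LΩ.sub_mem h1 h2 using 1
      ext i
      · simp only [Prod.fst_sub, Pi.sub_apply]; ring
      · simp
    · show ((fun i => E i j, 0) : (Fin (g0 + (n - 1)) → ℂ) × (Fin g0 → ℂ)) ∈ LΩ
      rw [hLΩ]; exact AddSubgroup.subset_closure (Or.inl (Or.inr ⟨j, rfl⟩))
  refine ⟨fun t => ⟨fwd t, fun ht => bwd ht⟩, fun h => ?_⟩
  rw [injective_iff_map_eq_zero]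
  intro q hq
  induction q using QuotientAddGroup.induction_on with
  | H t =>
    rw [QuotientAddGroup.map_mk, QuotientAddGroup.eq_zero_iff] at hq
    exact (QuotientAddGroup.eq_zero_iff t).2 (fwd t hq)
end

section
/- Let g0, n be natural numbers with n ≥ 1, set g1 = g0 + n − 1 and g = g1 + g0 = 2g0 + n − 1. Let A, D be complex (g1 × g0)-matrices, B, E complex (g1 × (n−1))-matrices, and G, J complex (g0 × g0)-matrices. Let Ω be the g × 2g block matrix with block rows [A B −A D E −D] and [G 0 G J 0 J], let L_Ω ⊆ ℂ^g be the ℤ-span of the columns of Ω, and let L_Δ ⊆ ℂ^{g0} be the ℤ-span of the columns of Δ = (G J). Assume the 2(g0+n−1) columns of the block matrix (A B D E) are linearly independent over ℤ. Then for every s ∈ ℂ^{g0}, the vector (0, s) ∈ ℂ^{g1} × ℂ^{g0} = ℂ^g lies in L_Ω if and only if s lies in 2L_Δ; consequently the additive group homomorphism ℂ^{g0}/2L_Δ → ℂ^g/L_Ω induced by s ↦ (0, s) is injective. -/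
open Matrix

/-- Ω is the period matrix of the Jacobian of a double cover, written in
blocks `[A B −A D E −D ; G 0 G J 0 J]`, `L_Ω ⊆ ℂ^g` is the ℤ-span of its columns, and
`Δ = (G J)` is the period matrix of `Jac(C₀)` with period lattice `L_Δ ⊆ ℂ^{g0}`.
If the `2(g0+n−1)` columns of `(A B D E)` are ℤ-linearly independent, then for every
`s ∈ ℂ^{g0}` the vector `(0, s) ∈ ℂ^{g1} × ℂ^{g0}` lies in `L_Ω` iff `s ∈ 2 L_Δ`;
consequently the induced group homomorphism `ℂ^{g0}/2L_Δ → ℂ^g/L_Ω` is injective. -/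
theorem jacobian_of_base_embeds_in_jacobian
    (g0 n : ℕ) (hn : 1 ≤ n)
    (A D : Matrix (Fin (g0 + (n - 1))) (Fin g0) ℂ)
    (B E : Matrix (Fin (g0 + (n - 1))) (Fin (n - 1)) ℂ)
    (G J : Matrix (Fin g0) (Fin g0) ℂ)
    (LΩ : AddSubgroup ((Fin (g0 + (n - 1)) → ℂ) × (Fin g0 → ℂ)))
    (hLΩ : LΩ = AddSubgroup.closure
      (Set.range (fun j : Fin g0 =>
          ((fun i => A i j, fun i => G i j) : (Fin (g0 + (n - 1)) → ℂ) × (Fin g0 → ℂ))) ∪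
       Set.range (fun j : Fin (n - 1) =>
          ((fun i => B i j, 0) : (Fin (g0 + (n - 1)) → ℂ) × (Fin g0 → ℂ))) ∪
       Set.range (fun j : Fin g0 =>
          ((fun i => -A i j, fun i => G i j) : (Fin (g0 + (n - 1)) → ℂ) × (Fin g0 → ℂ))) ∪
       Set.range (fun j : Fin g0 =>
          ((fun i => D i j, fun i => J i j) : (Fin (g0 + (n - 1)) → ℂ) × (Fin g0 → ℂ))) ∪
       Set.range (fun j : Fin (n - 1) =>
          ((fun i => E i j, 0) : (Fin (g0 + (n - 1)) → ℂ) × (Fin g0 → ℂ))) ∪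
       Set.range (fun j : Fin g0 =>
          ((fun i => -D i j, fun i => J i j) : (Fin (g0 + (n - 1)) → ℂ) × (Fin g0 → ℂ)))))
    (LΔ : AddSubgroup (Fin g0 → ℂ))
    (hLΔ : LΔ = AddSubgroup.closure
      (Set.range (fun j : Fin g0 => (fun i => G i j : Fin g0 → ℂ)) ∪
       Set.range (fun j : Fin g0 => (fun i => J i j : Fin g0 → ℂ))))
    (L2Δ : AddSubgroup (Fin g0 → ℂ))
    (hL2Δ : L2Δ = LΔ.map (zsmulAddGroupHom 2))
    (hindep : ∀ (k1 k3 : Fin g0 → ℤ) (k2 k4 : Fin (n - 1) → ℤ),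
      A.mulVec (fun j => (k1 j : ℂ)) + B.mulVec (fun j => (k2 j : ℂ)) +
        D.mulVec (fun j => (k3 j : ℂ)) + E.mulVec (fun j => (k4 j : ℂ)) = 0 →
      k1 = 0 ∧ k2 = 0 ∧ k3 = 0 ∧ k4 = 0) :
    (∀ s : Fin g0 → ℂ,
        (((0 : Fin (g0 + (n - 1)) → ℂ), s) ∈ LΩ ↔ s ∈ L2Δ)) ∧
    (∀ h : L2Δ ≤ LΩ.comap (AddMonoidHom.inr (Fin (g0 + (n - 1)) → ℂ) (Fin g0 → ℂ)),
      Function.Injective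
        (QuotientAddGroup.map L2Δ LΩ
          (AddMonoidHom.inr (Fin (g0 + (n - 1)) → ℂ) (Fin g0 → ℂ)) h)) := by
  have hG : ∀ j, (fun i => G i j : Fin g0 → ℂ) ∈ LΔ := fun j => by
    rw [hLΔ]; exact AddSubgroup.subset_closure (Or.inl ⟨j, rfl⟩)
  have hJ : ∀ j, (fun i => J i j : Fin g0 → ℂ) ∈ LΔ := fun j => by
    rw [hLΔ]; exact AddSubgroup.subset_closure (Or.inr ⟨j, rfl⟩)
  have hcol : ∀ {m k : ℕ} (M : Matrix (Fin m) (Fin k) ℂ) (j : Fin k) (c : ℤ),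
      M.mulVec (fun i => ((Pi.single j c : Fin k → ℤ) i : ℂ)) = fun i => (c : ℂ) * M i j := by
    intro m k M j c
    have : (fun i => ((Pi.single j c : Fin k → ℤ) i : ℂ)) = Pi.single j (c : ℂ) := by
      ext i
      by_cases h : i = j
      · subst h; simp
      · simp [h]
    rw [this, Matrix.mulVec_single]
    ext i
    simp [mul_comm]
  have hzero : ∀ {m k : ℕ} (M : Matrix (Fin m) (Fin k) ℂ),
      M.mulVec (fun i => (((0 : Fin k → ℤ) i : ℤ) : ℂ)) = 0 := by
    intro m k M
    have : (fun i => (((0 : Fin k → ℤ) i : ℤ) : ℂ)) = 0 := by ext i; simp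
    rw [this, Matrix.mulVec_zero]
  have hadd : ∀ {m k : ℕ} (M : Matrix (Fin m) (Fin k) ℂ) (a b : Fin k → ℤ),
      M.mulVec (fun i => (((a + b) i : ℤ) : ℂ)) =
        M.mulVec (fun i => (a i : ℂ)) + M.mulVec (fun i => (b i : ℂ)) := by
    intro m k M a b
    rw [← Matrix.mulVec_add]
    congr 1
    ext i; simp
  have hneg : ∀ {m k : ℕ} (M : Matrix (Fin m) (Fin k) ℂ) (a : Fin k → ℤ),
      M.mulVec (fun i => (((-a) i : ℤ) : ℂ)) = - M.mulVec (fun i => (a i : ℂ)) := by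
    intro m k M a
    rw [← Matrix.mulVec_neg]
    congr 1
    ext i; simp
  have key : ∀ x ∈ LΩ, ∃ (k1 k3 : Fin g0 → ℤ) (k2 k4 : Fin (n - 1) → ℤ), ∃ l ∈ LΔ,
      x.1 = A.mulVec (fun j => (k1 j : ℂ)) + B.mulVec (fun j => (k2 j : ℂ)) +
        D.mulVec (fun j => (k3 j : ℂ)) + E.mulVec (fun j => (k4 j : ℂ)) ∧
      x.2 = G.mulVec (fun j => (k1 j : ℂ)) + J.mulVec (fun j => (k3 j : ℂ)) + (2 : ℤ) • l := by
    intro x hx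
    rw [hLΩ] at hx
    induction hx using AddSubgroup.closure_induction with
    | mem x hx =>
      rcases hx with ((((⟨j, rfl⟩ | ⟨j, rfl⟩) | ⟨j, rfl⟩) | ⟨j, rfl⟩) | ⟨j, rfl⟩) | ⟨j, rfl⟩
      · refine ⟨Pi.single j 1, 0, 0, 0, 0, LΔ.zero_mem, ?_, ?_⟩ <;>
          simp only [hcol, hzero] <;> ext i <;> simp
      · refine ⟨0, 0, Pi.single j 1, 0, 0, LΔ.zero_mem, ?_, ?_⟩ <;>
          simp only [hcol, hzero] <;> ext i <;> simp
      · refine ⟨Pi.single j (-1), 0, 0, 0, _, hG j, ?_, ?_⟩ <;>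
          simp only [hcol, hzero] <;> ext i <;> simp <;> ring
      · refine ⟨0, Pi.single j 1, 0, 0, 0, LΔ.zero_mem, ?_, ?_⟩ <;>
          simp only [hcol, hzero] <;> ext i <;> simp
      · refine ⟨0, 0, 0, Pi.single j 1, 0, LΔ.zero_mem, ?_, ?_⟩ <;>
          simp only [hcol, hzero] <;> ext i <;> simp
      · refine ⟨0, Pi.single j (-1), 0, 0, _, hJ j, ?_, ?_⟩ <;>
          simp only [hcol, hzero] <;> ext i <;> simp <;> ring
    | zero =>
      refine ⟨0, 0, 0, 0, 0, LΔ.zero_mem, ?_, ?_⟩ <;> simp only [hzero] <;> simp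
    | add x y _ _ ihx ihy =>
      obtain ⟨a1, a3, a2, a4, l, hl, h1, h2⟩ := ihx
      obtain ⟨b1, b3, b2, b4, m, hm, h3, h4⟩ := ihy
      refine ⟨a1 + b1, a3 + b3, a2 + b2, a4 + b4, l + m, LΔ.add_mem hl hm, ?_, ?_⟩
      · rw [Prod.fst_add, h1, h3]; simp only [hadd]; abel
      · rw [Prod.snd_add, h2, h4]; simp only [hadd, smul_add]; abel
    | neg x _ ihx =>
      obtain ⟨a1, a3, a2, a4, l, hl, h1, h2⟩ := ihx
      refine ⟨-a1, -a3, -a2, -a4, -l, LΔ.neg_mem hl, ?_, ?_⟩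
      · rw [Prod.fst_neg, h1]; simp only [hneg]; abel
      · rw [Prod.snd_neg, h2]; simp only [hneg, smul_neg]; abel
  have conv : ∀ l ∈ LΔ, ((0 : Fin (g0 + (n - 1)) → ℂ), (2 : ℤ) • l) ∈ LΩ := by
    intro l hl
    rw [hLΔ] at hl
    induction hl using AddSubgroup.closure_induction with
    | mem x hx =>
      rcases hx with ⟨j, rfl⟩ | ⟨j, rfl⟩
      · have h1 : ((fun i => A i j, fun i => G i j) :
            (Fin (g0 + (n - 1)) → ℂ) × (Fin g0 → ℂ)) ∈ LΩ := by
          rw [hLΩ]; exact AddSubgroup.subset_closure (Or.inl (Or.inl (Or.inl (Or.inl (Or.inl ⟨j, rfl⟩)))))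
        have h2 : ((fun i => -A i j, fun i => G i j) :
            (Fin (g0 + (n - 1)) → ℂ) × (Fin g0 → ℂ)) ∈ LΩ := by
          rw [hLΩ]; exact AddSubgroup.subset_closure (Or.inl (Or.inl (Or.inl (Or.inr ⟨j, rfl⟩))))
        convert LΩ.add_mem h1 h2 using 1
        ext i
        · simp
        · simp [two_mul]
      · have h1 : ((fun i => D i j, fun i => J i j) :
            (Fin (g0 + (n - 1)) → ℂ) × (Fin g0 → ℂ)) ∈ LΩ := by
          rw [hLΩ]; exact AddSubgroup.subset_closure (Or.inl (Or.inl (Or.inr ⟨j, rfl⟩)))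
        have h2 : ((fun i => -D i j, fun i => J i j) :
            (Fin (g0 + (n - 1)) → ℂ) × (Fin g0 → ℂ)) ∈ LΩ := by
          rw [hLΩ]; exact AddSubgroup.subset_closure (Or.inr ⟨j, rfl⟩)
        convert LΩ.add_mem h1 h2 using 1
        ext i
        · simp
        · simp [two_mul]
    | zero => rw [smul_zero]; exact LΩ.zero_mem
    | add x y _ _ ihx ihy =>
      have h := LΩ.add_mem ihx ihy
      rwa [Prod.mk_add_mk, add_zero, ← smul_add] at h
    | neg x _ ihx =>
      have h := LΩ.neg_mem ihx
      rwa [Prod.neg_mk, neg_zero, ← smul_neg] at h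
  have main : ∀ s : Fin g0 → ℂ,
      (((0 : Fin (g0 + (n - 1)) → ℂ), s) ∈ LΩ ↔ s ∈ L2Δ) := by
    intro s
    rw [hL2Δ]
    constructor
    · intro hs
      obtain ⟨k1, k3, k2, k4, l, hl, h1, h2⟩ := key _ hs
      obtain ⟨rfl, rfl, rfl, rfl⟩ := hindep k1 k3 k2 k4 h1.symm
      refine ⟨l, hl, ?_⟩
      simp only [hzero, zero_add] at h2
      exact h2.symm
    · rintro ⟨l, hl, rfl⟩
      exact conv l hl
  refine ⟨main, fun h => ?_⟩
  rw [injective_iff_map_eq_zero]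
  intro q hq
  induction q using QuotientAddGroup.induction_on with
  | H s =>
    rw [QuotientAddGroup.map_mk, QuotientAddGroup.eq_zero_iff] at hq
    rw [QuotientAddGroup.eq_zero_iff]
    exact (main s).1 hq
end

section
/- Let g0, n be natural numbers with n ≥ 1, set g1 = g0 + n − 1 and g = g1 + g0. Let A, D be complex (g1 × g0)-matrices, B, E complex (g1 × (n−1))-matrices, and G, J complex (g0 × g0)-matrices. Let Ω be the g × 2g block matrix with block rows [A B −A D E −D] and [G 0 G J 0 J] and L_Ω ⊆ ℂ^g the ℤ-span of its columns. Assume the columns of (A B D E) are linearly independent over ℤ and the columns of (G J) are linearly independent over ℤ. Consider in the quotient group ℂ^g/L_Ω the image T₁ of the map t ↦ (t,0) mod L_Ω for t ∈ ℂ^{g1}, and the image T₂ of the map s ↦ (0,s) mod L_Ω for s ∈ ℂ^{g0}. Then the intersection T₁ ∩ T₂ is a finite subgroup of ℂ^g/L_Ω with exactly 2^{2g0} elements. -/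
open Matrix

theorem mem_closure_range_iff_exists_int {ι V : Type*} [Fintype ι] [AddCommGroup V] (f : ι → V) (v : V) :
    v ∈ AddSubgroup.closure (Set.range f) ↔ ∃ c : ι → ℤ, ∑ i, c i • f i = v := by
  rw [← Submodule.mem_span_range_iff_exists_fun ℤ, ← Submodule.span_int_eq_addSubgroupClosure]
  rfl

theorem sum_pair_eq {p q r : ℕ} (M : Matrix (Fin p) (Fin r) ℂ) (N : Matrix (Fin q) (Fin r) ℂ)
    (c : Fin r → ℤ) :
    ∑ j, c j • ((fun i => M i j, fun i => N i j) : (Fin p → ℂ) × (Fin q → ℂ)) =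
      (M.mulVec (fun j => (c j : ℂ)), N.mulVec (fun j => (c j : ℂ))) := by
  ext i
  · simp [Prod.fst_sum, Matrix.mulVec, dotProduct, mul_comm]
  · simp [Prod.snd_sum, Matrix.mulVec, dotProduct, mul_comm]

/-- With Ω the period matrix `[A B −A D E −D ; G 0 G J 0 J]` and
`L_Ω ⊆ ℂ^g` the ℤ-span of its columns, assume the columns of `(A B D E)` and of `(G J)`
are each ℤ-linearly independent. Let `T₁` be the image in `ℂ^g/L_Ω` of `t ↦ (t,0)` and
`T₂` the image of `s ↦ (0,s)`. Then `T₁ ∩ T₂` is finite with exactly `2^(2 g0)` elements. -/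
theorem prym_meets_jacobian_in_two_pow_points
    (g0 n : ℕ) (hn : 1 ≤ n)
    (A D : Matrix (Fin (g0 + (n - 1))) (Fin g0) ℂ)
    (B E : Matrix (Fin (g0 + (n - 1))) (Fin (n - 1)) ℂ)
    (G J : Matrix (Fin g0) (Fin g0) ℂ)
    (LΩ : AddSubgroup ((Fin (g0 + (n - 1)) → ℂ) × (Fin g0 → ℂ)))
    (hLΩ : LΩ = AddSubgroup.closure
      (Set.range (fun j : Fin g0 =>
          ((fun i => A i j, fun i => G i j) : (Fin (g0 + (n - 1)) → ℂ) × (Fin g0 → ℂ))) ∪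
       Set.range (fun j : Fin (n - 1) =>
          ((fun i => B i j, 0) : (Fin (g0 + (n - 1)) → ℂ) × (Fin g0 → ℂ))) ∪
       Set.range (fun j : Fin g0 =>
          ((fun i => -A i j, fun i => G i j) : (Fin (g0 + (n - 1)) → ℂ) × (Fin g0 → ℂ))) ∪
       Set.range (fun j : Fin g0 =>
          ((fun i => D i j, fun i => J i j) : (Fin (g0 + (n - 1)) → ℂ) × (Fin g0 → ℂ))) ∪
       Set.range (fun j : Fin (n - 1) =>
          ((fun i => E i j, 0) : (Fin (g0 + (n - 1)) → ℂ) × (Fin g0 → ℂ))) ∪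
       Set.range (fun j : Fin g0 =>
          ((fun i => -D i j, fun i => J i j) : (Fin (g0 + (n - 1)) → ℂ) × (Fin g0 → ℂ)))))
    (hindepABDE : ∀ (k1 k3 : Fin g0 → ℤ) (k2 k4 : Fin (n - 1) → ℤ),
      A.mulVec (fun j => (k1 j : ℂ)) + B.mulVec (fun j => (k2 j : ℂ)) +
        D.mulVec (fun j => (k3 j : ℂ)) + E.mulVec (fun j => (k4 j : ℂ)) = 0 →
      k1 = 0 ∧ k2 = 0 ∧ k3 = 0 ∧ k4 = 0)
    (hindepGJ : ∀ m m' : Fin g0 → ℤ,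
      G.mulVec (fun j => (m j : ℂ)) + J.mulVec (fun j => (m' j : ℂ)) = 0 →
      m = 0 ∧ m' = 0)
    (T1 T2 : Set (((Fin (g0 + (n - 1)) → ℂ) × (Fin g0 → ℂ)) ⧸ LΩ))
    (hT1 : T1 = Set.range (fun t : Fin (g0 + (n - 1)) → ℂ =>
      (QuotientAddGroup.mk ((t, (0 : Fin g0 → ℂ))) :
        ((Fin (g0 + (n - 1)) → ℂ) × (Fin g0 → ℂ)) ⧸ LΩ)))
    (hT2 : T2 = Set.range (fun s : Fin g0 → ℂ =>
      (QuotientAddGroup.mk (((0 : Fin (g0 + (n - 1)) → ℂ), s)) :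
        ((Fin (g0 + (n - 1)) → ℂ) × (Fin g0 → ℂ)) ⧸ LΩ))) :
    (T1 ∩ T2).Finite ∧ Nat.card ↥(T1 ∩ T2) = 2 ^ (2 * g0) := by
  have hmem : ∀ v : (Fin (g0 + (n - 1)) → ℂ) × (Fin g0 → ℂ), v ∈ LΩ ↔
      ∃ (k1 k3 k4 k6 : Fin g0 → ℤ) (k2 k5 : Fin (n - 1) → ℤ),
        v = (A.mulVec (fun j => ((k1 j - k3 j : ℤ) : ℂ)) + B.mulVec (fun j => (k2 j : ℂ)) +
          D.mulVec (fun j => ((k4 j - k6 j : ℤ) : ℂ)) + E.mulVec (fun j => (k5 j : ℂ)),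
          G.mulVec (fun j => ((k1 j + k3 j : ℤ) : ℂ)) +
          J.mulVec (fun j => ((k4 j + k6 j : ℤ) : ℂ))) := by
    intro v
    have key : ∀ (k1 k3 k4 k6 : Fin g0 → ℤ) (k2 k5 : Fin (n - 1) → ℤ),
        (∑ j, k1 j • ((fun i => A i j, fun i => G i j) :
            (Fin (g0 + (n - 1)) → ℂ) × (Fin g0 → ℂ))) +
        (∑ j, k2 j • ((fun i => B i j, 0) : (Fin (g0 + (n - 1)) → ℂ) × (Fin g0 → ℂ))) +
        (∑ j, k3 j • ((fun i => -A i j, fun i => G i j) :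
            (Fin (g0 + (n - 1)) → ℂ) × (Fin g0 → ℂ))) +
        (∑ j, k4 j • ((fun i => D i j, fun i => J i j) :
            (Fin (g0 + (n - 1)) → ℂ) × (Fin g0 → ℂ))) +
        (∑ j, k5 j • ((fun i => E i j, 0) : (Fin (g0 + (n - 1)) → ℂ) × (Fin g0 → ℂ))) +
        (∑ j, k6 j • ((fun i => -D i j, fun i => J i j) :
            (Fin (g0 + (n - 1)) → ℂ) × (Fin g0 → ℂ))) =
        (A.mulVec (fun j => ((k1 j - k3 j : ℤ) : ℂ)) + B.mulVec (fun j => (k2 j : ℂ)) +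
          D.mulVec (fun j => ((k4 j - k6 j : ℤ) : ℂ)) + E.mulVec (fun j => (k5 j : ℂ)),
          G.mulVec (fun j => ((k1 j + k3 j : ℤ) : ℂ)) +
          J.mulVec (fun j => ((k4 j + k6 j : ℤ) : ℂ))) := by
      intro k1 k3 k4 k6 k2 k5
      have e1 := sum_pair_eq A G k1
      have e2 := sum_pair_eq B (0 : Matrix (Fin g0) (Fin (n - 1)) ℂ) k2
      have e3 := sum_pair_eq (-A) G k3
      have e4 := sum_pair_eq D J k4
      have e5 := sum_pair_eq E (0 : Matrix (Fin g0) (Fin (n - 1)) ℂ) k5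
      have e6 := sum_pair_eq (-D) J k6
      have s1 : ∀ (p : ℕ) (M : Matrix (Fin p) (Fin g0) ℂ) (a b : Fin g0 → ℤ),
          M.mulVec (fun j => ((a j - b j : ℤ) : ℂ)) =
          M.mulVec (fun j => (a j : ℂ)) - M.mulVec (fun j => (b j : ℂ)) := by
        intro p M a b
        rw [← Matrix.mulVec_sub]; congr 1; ext j; simp
      have s2 : ∀ (p : ℕ) (M : Matrix (Fin p) (Fin g0) ℂ) (a b : Fin g0 → ℤ),
          M.mulVec (fun j => ((a j + b j : ℤ) : ℂ)) =
          M.mulVec (fun j => (a j : ℂ)) + M.mulVec (fun j => (b j : ℂ)) := by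
        intro p M a b
        rw [← Matrix.mulVec_add]; congr 1; ext j; simp
      refine (congrArg₂ (· + ·) (congrArg₂ (· + ·) (congrArg₂ (· + ·) (congrArg₂ (· + ·)
        (congrArg₂ (· + ·) e1 e2) e3) e4) e5) e6).trans ?_
      rw [s1, s1, s2, s2]
      simp only [Matrix.neg_mulVec, Matrix.zero_mulVec, Prod.mk_add_mk, Prod.mk.injEq]
      constructor <;> abel
    rw [hLΩ]
    simp only [AddSubgroup.closure_union, AddSubgroup.mem_sup, mem_closure_range_iff_exists_int]
    constructor
    · rintro ⟨_, ⟨_, ⟨_, ⟨_, ⟨_, ⟨k1, rfl⟩, _, ⟨k2, rfl⟩, rfl⟩, _, ⟨k3, rfl⟩, rfl⟩, _, ⟨k4, rfl⟩,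
        rfl⟩, _, ⟨k5, rfl⟩, rfl⟩, _, ⟨k6, rfl⟩, rfl⟩
      exact ⟨k1, k3, k4, k6, k2, k5, key _ _ _ _ _ _⟩
    · rintro ⟨k1, k3, k4, k6, k2, k5, rfl⟩
      exact ⟨_, ⟨_, ⟨_, ⟨_, ⟨_, ⟨k1, rfl⟩, _, ⟨k2, rfl⟩, rfl⟩, _, ⟨k3, rfl⟩, rfl⟩, _, ⟨k4, rfl⟩,
        rfl⟩, _, ⟨k5, rfl⟩, rfl⟩, _, ⟨k6, rfl⟩, key _ _ _ _ _ _⟩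
  let F : (Fin g0 → Fin 2) × (Fin g0 → Fin 2) →
      ((Fin (g0 + (n - 1)) → ℂ) × (Fin g0 → ℂ)) ⧸ LΩ := fun x =>
    QuotientAddGroup.mk (A.mulVec (fun j => (((x.1 j : ℕ) : ℤ) : ℂ)) +
      D.mulVec (fun j => (((x.2 j : ℕ) : ℤ) : ℂ)), 0)
  have hsub : ∀ (p r : ℕ) (M : Matrix (Fin p) (Fin r) ℂ) (a b : Fin r → ℤ),
      M.mulVec (fun j => ((a j - b j : ℤ) : ℂ)) =
      M.mulVec (fun j => (a j : ℂ)) - M.mulVec (fun j => (b j : ℂ)) := by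
    intro p r M a b
    rw [← Matrix.mulVec_sub]; congr 1; ext j; simp
  have hzero : ∀ (p r : ℕ) (M : Matrix (Fin p) (Fin r) ℂ),
      M.mulVec (fun _ => ((0 : ℤ) : ℂ)) = 0 := by
    intro p r M
    simp only [Int.cast_zero]; exact Matrix.mulVec_zero M
  have hFinj : Function.Injective F := by
    rintro ⟨x, y⟩ ⟨x', y'⟩ h
    simp only [F] at h
    rw [QuotientAddGroup.eq, hmem] at h
    obtain ⟨k1, k3, k4, k6, k2, k5, h⟩ := h
    simp only [Prod.neg_mk, Prod.mk_add_mk, Prod.mk.injEq, neg_zero, add_zero] at h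
    obtain ⟨h1, h2⟩ := h
    obtain ⟨hm, hp⟩ := hindepGJ (fun j => k1 j + k3 j) (fun j => k4 j + k6 j) h2.symm
    obtain ⟨ha, -, hd, -⟩ := hindepABDE
      (fun j => (k1 j - k3 j) - (((x' j : ℕ) : ℤ) - ((x j : ℕ) : ℤ)))
      (fun j => (k4 j - k6 j) - (((y' j : ℕ) : ℤ) - ((y j : ℕ) : ℤ))) k2 k5 (by
        have t1 := hsub _ _ A (fun j => k1 j - k3 j) (fun j => ((x' j : ℕ) : ℤ) - ((x j : ℕ) : ℤ))
        have t2 := hsub _ _ D (fun j => k4 j - k6 j) (fun j => ((y' j : ℕ) : ℤ) - ((y j : ℕ) : ℤ))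
        have t3 := hsub _ _ A (fun j => ((x' j : ℕ) : ℤ)) (fun j => ((x j : ℕ) : ℤ))
        have t4 := hsub _ _ D (fun j => ((y' j : ℕ) : ℤ)) (fun j => ((y j : ℕ) : ℤ))
        rw [t1, t2, t3, t4]
        rw [← sub_eq_zero] at h1
        rw [← neg_eq_zero, ← h1]
        abel)
    rw [Prod.mk.injEq]
    constructor
    · funext j
      have q1 := congrFun hm j
      have q2 := congrFun ha j
      simp only [Pi.zero_apply] at q1 q2
      apply Fin.ext
      have := (x j).isLt
      have := (x' j).isLt
      omega
    · funext j
      have q1 := congrFun hp j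
      have q2 := congrFun hd j
      simp only [Pi.zero_apply] at q1 q2
      apply Fin.ext
      have := (y j).isLt
      have := (y' j).isLt
      omega
  have hrange : T1 ∩ T2 = Set.range F := by
    subst hT1 hT2
    ext q
    constructor
    · rintro ⟨⟨t, rfl⟩, ⟨s, hs⟩⟩
      simp only at hs
      rw [QuotientAddGroup.eq, hmem] at hs
      obtain ⟨k1, k3, k4, k6, k2, k5, h⟩ := hs
      simp only [Prod.neg_mk, Prod.mk_add_mk, Prod.mk.injEq, neg_zero, add_zero, zero_add] at h
      obtain ⟨h1, -⟩ := h
      refine ⟨(fun j => ⟨((k1 j - k3 j) % 2).toNat, by omega⟩,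
        fun j => ⟨((k4 j - k6 j) % 2).toNat, by omega⟩), ?_⟩
      simp only [F]
      rw [QuotientAddGroup.eq, hmem]
      refine ⟨fun j => (k1 j - k3 j) / 2, fun j => - ((k1 j - k3 j) / 2),
        fun j => (k4 j - k6 j) / 2, fun j => - ((k4 j - k6 j) / 2), k2, k5, ?_⟩
      have u : ∀ z : ℤ, z / 2 - -(z / 2) = z - ((z % 2).toNat : ℤ) := by intro z; omega
      have w : ∀ z : ℤ, z + -z = 0 := by intro z; omega
      simp only [u, w, hzero, Prod.neg_mk, Prod.mk_add_mk, Prod.mk.injEq, neg_zero, add_zero,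
        and_true]
      rw [h1, hsub _ _ A (fun j => k1 j - k3 j), hsub _ _ D (fun j => k4 j - k6 j)]
      abel
    · rintro ⟨⟨x, y⟩, rfl⟩
      refine ⟨⟨_, rfl⟩, ⟨-(G.mulVec (fun j => (((x j : ℕ) : ℤ) : ℂ)) +
        J.mulVec (fun j => (((y j : ℕ) : ℤ) : ℂ))), ?_⟩⟩
      simp only [F]
      rw [QuotientAddGroup.eq, hmem]
      refine ⟨fun j => ((x j : ℕ) : ℤ), fun _ => 0, fun j => ((y j : ℕ) : ℤ), fun _ => 0,
        fun _ => 0, fun _ => 0, ?_⟩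
      simp only [sub_zero, add_zero, hzero, Prod.neg_mk, Prod.mk_add_mk, neg_zero, zero_add,
        neg_neg]
  rw [hrange]
  refine ⟨Set.finite_range F, ?_⟩
  rw [Nat.card_range_of_injective hFinj]
  simp [two_mul, pow_add]
end

section
/- Let a, b ∈ ℝ and let q1, q2, p1, p2 : ℝ → ℝ be differentiable functions satisfying the Hénon–Heiles equations q1' = p1, q2' = p2, p1' = −a·q1 − 2·q1·q2, p2' = −b·q2 − q1² − 6·q2². Then the function H2(t) = q1(t)⁴ + 4·q1(t)²·q2(t)² − 4·p1(t)·(p1(t)·q2(t) − p2(t)·q1(t)) + 4a·q1(t)²·q2(t) + (4a − b)·(p1(t)² + a·q1(t)²) is constant on ℝ. -/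
/-- Along any solution of the Hénon–Heiles equations
`q1' = p1, q2' = p2, p1' = −a q1 − 2 q1 q2, p2' = −b q2 − q1² − 6 q2²`, the second
invariant `H2 = q1⁴ + 4 q1² q2² − 4 p1 (p1 q2 − p2 q1) + 4a q1² q2 + (4a − b)(p1² + a q1²)`
is constant. -/
theorem henonHeiles_H2_constant (a b : ℝ) (q1 q2 p1 p2 : ℝ → ℝ)
    (hq1 : ∀ t, HasDerivAt q1 (p1 t) t)
    (hq2 : ∀ t, HasDerivAt q2 (p2 t) t)
    (hp1 : ∀ t, HasDerivAt p1 (-(a * q1 t) - 2 * q1 t * q2 t) t)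
    (hp2 : ∀ t, HasDerivAt p2 (-(b * q2 t) - q1 t ^ 2 - 6 * q2 t ^ 2) t) :
    ∀ s t : ℝ,
      q1 s ^ 4 + 4 * q1 s ^ 2 * q2 s ^ 2 - 4 * p1 s * (p1 s * q2 s - p2 s * q1 s)
          + 4 * a * q1 s ^ 2 * q2 s + (4 * a - b) * (p1 s ^ 2 + a * q1 s ^ 2)
        = q1 t ^ 4 + 4 * q1 t ^ 2 * q2 t ^ 2 - 4 * p1 t * (p1 t * q2 t - p2 t * q1 t)
          + 4 * a * q1 t ^ 2 * q2 t + (4 * a - b) * (p1 t ^ 2 + a * q1 t ^ 2) := by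
  have key : ∀ x, HasDerivAt (fun t => q1 t ^ 4 + 4 * q1 t ^ 2 * q2 t ^ 2
      - 4 * p1 t * (p1 t * q2 t - p2 t * q1 t)
      + 4 * a * q1 t ^ 2 * q2 t + (4 * a - b) * (p1 t ^ 2 + a * q1 t ^ 2)) 0 x := by
    intro x
    have h1 := hq1 x
    have h2 := hq2 x
    have h3 := hp1 x
    have h4 := hp2 x
    have h := (((((h1.fun_pow 4).fun_add (((h1.fun_pow 2).const_mul 4).fun_mul (h2.fun_pow 2))).fun_sub
      ((h3.const_mul 4).fun_mul ((h3.fun_mul h2).fun_sub (h4.fun_mul h1)))).fun_add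
      (((h1.fun_pow 2).const_mul (4 * a)).fun_mul h2)).fun_add
      (((h3.fun_pow 2).fun_add ((h1.fun_pow 2).const_mul a)).const_mul (4 * a - b)))
    refine h.congr_deriv ?_
    push_cast
    ring
  intro s t
  exact is_const_of_deriv_eq_zero (fun x => (key x).differentiableAt)
    (fun x => (key x).deriv) s t
end

section
/- Let a, b ∈ ℝ. Define H1, H2 : ℝ⁴ → ℝ on coordinates (q1, q2, p1, p2) by H1 = ½(p1² + p2² + a·q1² + b·q2²) + q1²·q2 + 2·q2³ and H2 = q1⁴ + 4·q1²·q2² − 4·p1·(p1·q2 − p2·q1) + 4a·q1²·q2 + (4a − b)·(p1² + a·q1²). Then the canonical Poisson bracket {H2, H1} = (∂H2/∂q1)(∂H1/∂p1) + (∂H2/∂q2)(∂H1/∂p2) − (∂H2/∂p1)(∂H1/∂q1) − (∂H2/∂p2)(∂H1/∂q2) vanishes identically on ℝ⁴. -/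
/-- The Hénon–Heiles Hamiltonian `H1 = ½(p1² + p2² + a q1² + b q2²) + q1² q2 + 2 q2³`. -/
noncomputable def henonHeilesH1 (a b q1 q2 p1 p2 : ℝ) : ℝ :=
  (1 / 2) * (p1 ^ 2 + p2 ^ 2 + a * q1 ^ 2 + b * q2 ^ 2) + q1 ^ 2 * q2 + 2 * q2 ^ 3

/-- The second Hénon–Heiles invariant
`H2 = q1⁴ + 4 q1² q2² − 4 p1 (p1 q2 − p2 q1) + 4a q1² q2 + (4a − b)(p1² + a q1²)`. -/
noncomputable def henonHeilesH2 (a b q1 q2 p1 p2 : ℝ) : ℝ :=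
  q1 ^ 4 + 4 * q1 ^ 2 * q2 ^ 2 - 4 * p1 * (p1 * q2 - p2 * q1)
    + 4 * a * q1 ^ 2 * q2 + (4 * a - b) * (p1 ^ 2 + a * q1 ^ 2)

/-- Derivative of a function that agrees with a quartic polynomial. -/
theorem deriv_of_eq_quartic (f : ℝ → ℝ) (c0 c1 c2 c3 c4 y : ℝ)
    (hf : ∀ x, f x = c0 + c1 * x + c2 * x ^ 2 + c3 * x ^ 3 + c4 * x ^ 4) :
    deriv f y = c1 + 2 * c2 * y + 3 * c3 * y ^ 2 + 4 * c4 * y ^ 3 := by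
  have h : HasDerivAt (fun x : ℝ => c0 + c1 * x + c2 * x ^ 2 + c3 * x ^ 3 + c4 * x ^ 4)
      (0 + c1 * 1 + c2 * ((2 : ℕ) * y ^ (2 - 1)) + c3 * ((3 : ℕ) * y ^ (3 - 1))
        + c4 * ((4 : ℕ) * y ^ (4 - 1))) y :=
    (((((hasDerivAt_const y c0).add ((hasDerivAt_id y).const_mul c1)).add
      ((hasDerivAt_pow 2 y).const_mul c2)).add ((hasDerivAt_pow 3 y).const_mul c3)).add
      ((hasDerivAt_pow 4 y).const_mul c4))
  rw [funext hf, h.deriv]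
  norm_num
  ring

/-- The canonical Poisson bracket
`{H2, H1} = ∂H2/∂q1 ∂H1/∂p1 + ∂H2/∂q2 ∂H1/∂p2 − ∂H2/∂p1 ∂H1/∂q1 − ∂H2/∂p2 ∂H1/∂q2`
vanishes identically on ℝ⁴. -/
theorem henonHeiles_poisson_bracket_vanishes (a b : ℝ) :
    ∀ q1 q2 p1 p2 : ℝ,
      deriv (fun x => henonHeilesH2 a b x q2 p1 p2) q1
          * deriv (fun x => henonHeilesH1 a b q1 q2 x p2) p1
        + deriv (fun x => henonHeilesH2 a b q1 x p1 p2) q2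
          * deriv (fun x => henonHeilesH1 a b q1 q2 p1 x) p2
        - deriv (fun x => henonHeilesH2 a b q1 q2 x p2) p1
          * deriv (fun x => henonHeilesH1 a b x q2 p1 p2) q1
        - deriv (fun x => henonHeilesH2 a b q1 q2 p1 x) p2
          * deriv (fun x => henonHeilesH1 a b q1 x p1 p2) q2 = 0 := by
  intro q1 q2 p1 p2
  rw [deriv_of_eq_quartic (fun x => henonHeilesH2 a b x q2 p1 p2)
      (-4 * p1 ^ 2 * q2 + (4 * a - b) * p1 ^ 2) (4 * p1 * p2)
      (4 * q2 ^ 2 + 4 * a * q2 + (4 * a - b) * a) 0 1 q1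
      (fun x => by simp only [henonHeilesH2]; ring),
    deriv_of_eq_quartic (fun x => henonHeilesH1 a b q1 q2 x p2)
      (henonHeilesH1 a b q1 q2 0 p2) 0 (1 / 2) 0 0 p1
      (fun x => by simp only [henonHeilesH1]; ring),
    deriv_of_eq_quartic (fun x => henonHeilesH2 a b q1 x p1 p2)
      (henonHeilesH2 a b q1 0 p1 p2) (-4 * p1 ^ 2 + 4 * a * q1 ^ 2) (4 * q1 ^ 2) 0 0 q2
      (fun x => by simp only [henonHeilesH2]; ring),
    deriv_of_eq_quartic (fun x => henonHeilesH1 a b q1 q2 p1 x)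
      (henonHeilesH1 a b q1 q2 p1 0) 0 (1 / 2) 0 0 p2
      (fun x => by simp only [henonHeilesH1]; ring),
    deriv_of_eq_quartic (fun x => henonHeilesH2 a b q1 q2 x p2)
      (henonHeilesH2 a b q1 q2 0 p2) (4 * p2 * q1) (-4 * q2 + (4 * a - b)) 0 0 p1
      (fun x => by simp only [henonHeilesH2]; ring),
    deriv_of_eq_quartic (fun x => henonHeilesH1 a b x q2 p1 p2)
      (henonHeilesH1 a b 0 q2 p1 p2) 0 (a / 2 + q2) 0 0 q1
      (fun x => by simp only [henonHeilesH1]; ring),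
    deriv_of_eq_quartic (fun x => henonHeilesH2 a b q1 q2 p1 x)
      (henonHeilesH2 a b q1 q2 p1 0) (4 * p1 * q1) 0 0 0 p2
      (fun x => by simp only [henonHeilesH2]; ring),
    deriv_of_eq_quartic (fun x => henonHeilesH1 a b q1 x p1 p2)
      (henonHeilesH1 a b q1 0 p1 p2) (q1 ^ 2) (b / 2) 2 0 q2
      (fun x => by simp only [henonHeilesH1]; ring)]
  ring
end

section
/- Let m1, m2, m3, γ1, γ2, γ3 : ℝ → ℂ be differentiable functions satisfying the Kowalewski equations m1' = m2·m3, m2' = −m1·m3 + 2·γ3, m3' = −2·γ2, γ1' = 2·m3·γ2 − m2·γ3, γ2' = m1·γ3 − 2·m3·γ1, γ3' = m2·γ1 − m1·γ2. Then the function H4(t) = (((m1(t) + i·m2(t))/2)² − (γ1(t) + i·γ2(t))) · (((m1(t) − i·m2(t))/2)² − (γ1(t) − i·γ2(t))) is constant on ℝ. -/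
open Complex

/-- Along any complex-valued solution of the Kowalewski equations, the
Kowalewski quartic invariant
`H4 = ((m1 + i m2)²/4 − (γ1 + i γ2)) ((m1 − i m2)²/4 − (γ1 − i γ2))` is constant. -/
theorem kowalewski_H4_constant (m1 m2 m3 γ1 γ2 γ3 : ℝ → ℂ)
    (hm1 : ∀ t, HasDerivAt m1 (m2 t * m3 t) t)
    (hm2 : ∀ t, HasDerivAt m2 (-(m1 t * m3 t) + 2 * γ3 t) t)
    (hm3 : ∀ t, HasDerivAt m3 (-2 * γ2 t) t)
    (hγ1 : ∀ t, HasDerivAt γ1 (2 * m3 t * γ2 t - m2 t * γ3 t) t)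
    (hγ2 : ∀ t, HasDerivAt γ2 (m1 t * γ3 t - 2 * m3 t * γ1 t) t)
    (hγ3 : ∀ t, HasDerivAt γ3 (m2 t * γ1 t - m1 t * γ2 t) t) :
    ∀ s t : ℝ,
      (((m1 s + I * m2 s) / 2) ^ 2 - (γ1 s + I * γ2 s))
          * (((m1 s - I * m2 s) / 2) ^ 2 - (γ1 s - I * γ2 s))
        = (((m1 t + I * m2 t) / 2) ^ 2 - (γ1 t + I * γ2 t))
          * (((m1 t - I * m2 t) / 2) ^ 2 - (γ1 t - I * γ2 t)) := by
  have hA : ∀ t, HasDerivAt (fun t => ((m1 t + I * m2 t) / 2) ^ 2 - (γ1 t + I * γ2 t))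
      (-2 * I * m3 t * (((m1 t + I * m2 t) / 2) ^ 2 - (γ1 t + I * γ2 t))) t := by
    intro t
    have h := ((((hm1 t).add ((hm2 t).const_mul I)).div_const 2).pow 2).sub
      ((hγ1 t).add ((hγ2 t).const_mul I))
    refine h.congr_deriv ?_
    simp
    linear_combination (m1 t * m2 t * m3 t / 2 + I * m2 t ^ 2 * m3 t / 2
      + m2 t * γ3 t - 2 * m3 t * γ2 t) * I_sq
  have hB : ∀ t, HasDerivAt (fun t => ((m1 t - I * m2 t) / 2) ^ 2 - (γ1 t - I * γ2 t))
      (2 * I * m3 t * (((m1 t - I * m2 t) / 2) ^ 2 - (γ1 t - I * γ2 t))) t := by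
    intro t
    have h := ((((hm1 t).sub ((hm2 t).const_mul I)).div_const 2).pow 2).sub
      ((hγ1 t).sub ((hγ2 t).const_mul I))
    refine h.congr_deriv ?_
    simp
    linear_combination (m1 t * m2 t * m3 t / 2 - I * m2 t ^ 2 * m3 t / 2
      + m2 t * γ3 t - 2 * m3 t * γ2 t) * I_sq
  have hAB := fun t => ((hA t).mul (hB t)).congr_deriv (g' := 0) (by ring)
  intro s t
  exact is_const_of_deriv_eq_zero (fun t => (hAB t).differentiableAt)
    (fun t => (hAB t).deriv) s t
end

section
/- Let a1, a2, a3, b1, b2, b3, ρ ∈ ℝ satisfy the Clebsch conditions ρ·(a2 − a3) = b1·(b2 − b3), ρ·(a3 − a1) = b2·(b3 − b1), and ρ·(a1 − a2) = b3·(b1 − b2). Let p1, p2, p3, l1, l2, l3 : ℝ → ℝ be differentiable functions satisfying the Kirchhoff equations for the Hamiltonian H = ½(a1·p1² + a2·p2² + a3·p3² + b1·l1² + b2·l2² + b3·l3²), namely p1' = b3·p2·l3 − b2·p3·l2, p2' = b1·p3·l1 − b3·p1·l3, p3' = b2·p1·l2 − b1·p2·l1, l1' = (a3 − a2)·p2·p3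 + (b3 − b2)·l2·l3, l2' = (a1 − a3)·p1·p3 + (b1 − b3)·l1·l3, l3' = (a2 − a1)·p1·p2 + (b2 − b1)·l1·l2. Then the function H4(t) = ½·(b1·p1(t)² + b2·p2(t)² + b3·p3(t)² + ρ·(l1(t)² + l2(t)² + l3(t)²)) is constant on ℝ. -/
/-- In Clebsch's case of Kirchhoff's equations, with parameters
satisfying `ρ(a2−a3) = b1(b2−b3)`, `ρ(a3−a1) = b2(b3−b1)`, `ρ(a1−a2) = b3(b1−b2)`,
the quantity `H4 = ½(b1 p1² + b2 p2² + b3 p3² + ρ(l1² + l2² + l3²))` is a constant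
of motion. -/
theorem clebsch_H4_constant (a1 a2 a3 b1 b2 b3 ρ : ℝ)
    (hρ1 : ρ * (a2 - a3) = b1 * (b2 - b3))
    (hρ2 : ρ * (a3 - a1) = b2 * (b3 - b1))
    (hρ3 : ρ * (a1 - a2) = b3 * (b1 - b2))
    (p1 p2 p3 l1 l2 l3 : ℝ → ℝ)
    (hp1 : ∀ t, HasDerivAt p1 (b3 * p2 t * l3 t - b2 * p3 t * l2 t) t)
    (hp2 : ∀ t, HasDerivAt p2 (b1 * p3 t * l1 t - b3 * p1 t * l3 t) t)
    (hp3 : ∀ t, HasDerivAt p3 (b2 * p1 t * l2 t - b1 * p2 t * l1 t) t)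
    (hl1 : ∀ t, HasDerivAt l1 ((a3 - a2) * p2 t * p3 t + (b3 - b2) * l2 t * l3 t) t)
    (hl2 : ∀ t, HasDerivAt l2 ((a1 - a3) * p1 t * p3 t + (b1 - b3) * l1 t * l3 t) t)
    (hl3 : ∀ t, HasDerivAt l3 ((a2 - a1) * p1 t * p2 t + (b2 - b1) * l1 t * l2 t) t) :
    ∀ s t : ℝ,
      (1 / 2) * (b1 * p1 s ^ 2 + b2 * p2 s ^ 2 + b3 * p3 s ^ 2
          + ρ * (l1 s ^ 2 + l2 s ^ 2 + l3 s ^ 2))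
        = (1 / 2) * (b1 * p1 t ^ 2 + b2 * p2 t ^ 2 + b3 * p3 t ^ 2
          + ρ * (l1 t ^ 2 + l2 t ^ 2 + l3 t ^ 2)) := by
  have key : ∀ x, HasDerivAt (fun t => (1 / 2) * (b1 * p1 t ^ 2 + b2 * p2 t ^ 2 + b3 * p3 t ^ 2
          + ρ * (l1 t ^ 2 + l2 t ^ 2 + l3 t ^ 2))) 0 x := by
    intro x
    have h := ((((((hp1 x).fun_pow 2).const_mul b1).fun_add (((hp2 x).fun_pow 2).const_mul b2)).fun_add
      (((hp3 x).fun_pow 2).const_mul b3)).fun_add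
      (((((hl1 x).fun_pow 2).fun_add ((hl2 x).fun_pow 2)).fun_add
        ((hl3 x).fun_pow 2)).const_mul ρ)).const_mul (1 / 2 : ℝ)
    refine h.congr_deriv ?_
    norm_num
    linear_combination (-2 * (p2 x * p3 x * l1 x)) * hρ1 - 2 * (p1 x * p3 x * l2 x) * hρ2
      - 2 * (p1 x * p2 x * l3 x) * hρ3
  intro s t
  exact is_const_of_deriv_eq_zero (fun x => (key x).differentiableAt) (fun x => (key x).deriv) s t
end
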